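/- For all u, v, x, y ∈ W, one has u ◁ v ≤ x ∗ y in Bruhat order if and only if u ≤ (x ∗ y) ∗ v⁻¹ in Bruhat order. -/

import Mathlib

/-! Common setup: a finite Coxeter system, Bruhat order, and the sets
`{u * y : u ≤ x}` and `{x * v : v ≤ y}` used to characterize the
Demazure product `∗` and the operations `▷`, `◁`. -/

/-- The Bruhat order on a Coxeter group: the reflexive-transitive closure of
the relation `u → u * t`, where `t` is a reflection and right multiplication
by `t` increases length. -/
def CoxeterSystem.bruhatLE {B W : Type*} [Group W] {M : CoxeterMatrix B}
    (cs : CoxeterSystem M W) : W → W → Prop :=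
  Relation.ReflTransGen
    (fun u v => ∃ t, cs.IsReflection t ∧ v = u * t ∧ cs.length u < cs.length v)

/-- The set `{u * y : u ∈ W, u ≤ x}`. -/
def CoxeterSystem.lset {B W : Type*} [Group W] {M : CoxeterMatrix B}
    (cs : CoxeterSystem M W) (x y : W) : Set W :=
  {z | ∃ u, cs.bruhatLE u x ∧ z = u * y}

/-- The set `{x * v : v ∈ W, v ≤ y}`. -/
def CoxeterSystem.rset {B W : Type*} [Group W] {M : CoxeterMatrix B}
    (cs : CoxeterSystem M W) (x y : W) : Set W :=
  {z | ∃ v, cs.bruhatLE v y ∧ z = x * v}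

namespace CoxeterSystem

variable {B W : Type*} [Group W] {M : CoxeterMatrix B} (cs : CoxeterSystem M W)

open Classical in
/-- The signed conjugation action of a simple reflection: it conjugates the first component, and
flips the sign exactly when that component is the simple reflection itself. -/
noncomputable def signedConj (i : B) : Equiv.Perm (W × ZMod 2) :=
  Function.Involutive.toPerm
    (fun p => (cs.simple i * p.1 * cs.simple i, p.2 + if p.1 = cs.simple i then 1 else 0)) (by
      rintro ⟨t, ε⟩
      have h : cs.simple i * t * cs.simple i = cs.simple i ↔ t = cs.simple i := by
        rw [mul_eq_right, mul_eq_one_iff_inv_eq, cs.inv_simple, eq_comm]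
      have h2 : (1 : ZMod 2) + 1 = 0 := by decide
      ext
      · simp [mul_assoc]
      · by_cases ht : t = cs.simple i
        · simp [ht, add_assoc, h2]
        · simp only [h, ht, if_false, add_zero])

open Classical in
theorem signedConj_apply (i : B) (t : W) (ε : ZMod 2) :
    cs.signedConj i (t, ε) =
      (cs.simple i * t * cs.simple i, ε + if t = cs.simple i then 1 else 0) := rfl

open Classical in
theorem prod_map_signedConj_apply (ω : List B) (t : W) (ε : ZMod 2) :
    (ω.map cs.signedConj).prod (t, ε) =
      (cs.wordProd ω * t * (cs.wordProd ω)⁻¹, ε + ((cs.rightInvSeq ω).count t : ZMod 2)) := by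
  induction ω with
  | nil => simp
  | cons i ω ih =>
    rw [List.map_cons, List.prod_cons, Equiv.Perm.mul_apply, ih, signedConj_apply,
      rightInvSeq, List.count_cons, wordProd_cons]
    have h : cs.wordProd ω * t * (cs.wordProd ω)⁻¹ = cs.simple i ↔
        (cs.wordProd ω)⁻¹ * cs.simple i * cs.wordProd ω = t := by
      rw [mul_inv_eq_iff_eq_mul, mul_assoc, inv_mul_eq_iff_eq_mul, eq_comm]
    ext
    · simp [mul_assoc]
    · simp [h, add_assoc]

open Classical in
theorem even_count_leftInvSeq_alternatingWord (i j : B) (t : W) :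
    Even ((cs.leftInvSeq (alternatingWord i j (2 * M i j))).count t) := by
  set l := cs.leftInvSeq (alternatingWord i j (2 * M i j)) with hl
  have hlen : l.length = 2 * M i j := by simp [hl]
  have h : l.drop (M i j) = l.take (M i j) := by
    apply List.ext_getElem
    · simp [hlen]; lia
    · intro k h₁ h₂
      have hk : k < M i j := by simp at h₂; lia
      rw [List.getElem_drop, List.getElem_take]
      simp only [hl]
      rw [cs.getElem_leftInvSeq_alternatingWord i j _ _ (by lia),
        cs.getElem_leftInvSeq_alternatingWord i j _ _ (by lia),
        prod_alternatingWord_eq_mul_pow, prod_alternatingWord_eq_mul_pow]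
      have e₁ : (2 * (M i j + k) + 1) / 2 = M i j + k := by lia
      have e₂ : (2 * k + 1) / 2 = k := by lia
      have o : ∀ n, ¬ Even (2 * n + 1) := fun n => by simp
      simp [e₁, e₂, o, pow_add]
  rw [← List.take_append_drop (M i j) l, h, List.count_append]
  exact ⟨_, rfl⟩

theorem isLiftable_signedConj : M.IsLiftable cs.signedConj := by
  classical
  intro i j
  have h : (cs.signedConj i * cs.signedConj j) ^ M i j =
      ((alternatingWord i j (2 * M i j)).map cs.signedConj).prod := by
    generalize M i j = m
    induction m with
    | zero => simp [alternatingWord]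
    | succ m ih =>
      rw [pow_succ', ih, mul_add, mul_one, alternatingWord_succ', alternatingWord_succ']
      simp [mul_assoc]
  rw [h]
  ext1 ⟨t, ε⟩
  have hω : cs.wordProd (alternatingWord i j (2 * M i j)) = 1 := by
    simp [prod_alternatingWord_eq_mul_pow]
  have hc : (cs.rightInvSeq (alternatingWord i j (2 * M i j))).count t =
      (cs.leftInvSeq (alternatingWord j i (2 * M j i))).count t := by
    have hrev : alternatingWord i j (2 * M i j) = (alternatingWord j i (2 * M j i)).reverse := by
      rw [M.symmetric j i]
      apply List.ext_getElem
      · simp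
      · intro k h₁ h₂
        rw [length_alternatingWord] at h₁
        rw [List.getElem_reverse, getElem_alternatingWord _ _ _ _ h₁,
          getElem_alternatingWord _ _ _ _ (by simp; lia)]
        grind [length_alternatingWord]
    rw [hrev, rightInvSeq_reverse, List.count_reverse]
  rw [prod_map_signedConj_apply, hω, hc,
    (ZMod.natCast_eq_zero_iff_even).2 (cs.even_count_leftInvSeq_alternatingWord j i t)]
  simp

/-- The parity of the number of occurrences of `t` in the right inversion sequence of any word
for `w`. -/
noncomputable def inversionParity (w t : W) : ZMod 2 :=
  (cs.lift ⟨cs.signedConj, cs.isLiftable_signedConj⟩ w (t, 0)).2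

theorem lift_signedConj_wordProd (ω : List B) :
    cs.lift ⟨cs.signedConj, cs.isLiftable_signedConj⟩ (cs.wordProd ω) =
      (ω.map cs.signedConj).prod := by
  induction ω with
  | nil => simp
  | cons i ω ih => rw [wordProd_cons, map_mul, ih, lift_apply_simple]; simp

open Classical in
theorem inversionParity_wordProd (ω : List B) (t : W) :
    cs.inversionParity (cs.wordProd ω) t = ((cs.rightInvSeq ω).count t : ZMod 2) := by
  rw [inversionParity, lift_signedConj_wordProd, prod_map_signedConj_apply, zero_add]

theorem lift_signedConj_apply (w t : W) (ε : ZMod 2) :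
    cs.lift ⟨cs.signedConj, cs.isLiftable_signedConj⟩ w (t, ε) =
      (w * t * w⁻¹, ε + cs.inversionParity w t) := by
  classical
  obtain ⟨ω, rfl⟩ := cs.wordProd_surjective w
  rw [inversionParity_wordProd, lift_signedConj_wordProd, prod_map_signedConj_apply]

theorem inversionParity_mul (w₁ w₂ t : W) :
    cs.inversionParity (w₁ * w₂) t =
      cs.inversionParity w₂ t + cs.inversionParity w₁ (w₂ * t * w₂⁻¹) := by
  rw [inversionParity, map_mul, Equiv.Perm.mul_apply, lift_signedConj_apply,
    lift_signedConj_apply, zero_add]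

theorem inversionParity_one (t : W) : cs.inversionParity 1 t = 0 := by
  simp [inversionParity]

open Classical in
theorem inversionParity_simple (i : B) (t : W) :
    cs.inversionParity (cs.simple i) t = if t = cs.simple i then 1 else 0 := by
  rw [inversionParity, lift_apply_simple, signedConj_apply, zero_add]

variable {cs} in
theorem IsReflection.inversionParity_self {t : W} (ht : cs.IsReflection t) :
    cs.inversionParity t t = 1 := by
  classical
  obtain ⟨w, i, rfl⟩ := ht
  have h := cs.inversionParity_mul w w⁻¹ (w * cs.simple i * w⁻¹)
  have e : w⁻¹ * (w * cs.simple i * w⁻¹) * w⁻¹⁻¹ = cs.simple i := by group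
  rw [mul_inv_cancel, inversionParity_one, e] at h
  rw [inversionParity_mul, e, inversionParity_mul, inversionParity_simple, if_pos rfl,
    mul_inv_cancel_right]
  linear_combination -h

variable {cs} in
/-- The inversions of `w` are exactly the reflections of odd inversion parity, which is a form of
the strong exchange property. -/
theorem IsReflection.isRightInversion_iff {t : W} (ht : cs.IsReflection t) (w : W) :
    cs.IsRightInversion w t ↔ cs.inversionParity w t = 1 := by
  classical
  have key : ∀ w, cs.inversionParity w t = 1 → cs.IsRightInversion w t := by
    intro w hw
    obtain ⟨ω, hω, rfl⟩ := cs.exists_isReduced w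
    rw [inversionParity_wordProd] at hw
    refine cs.isRightInversion_of_mem_rightInvSeq hω (List.count_pos_iff.1 ?_)
    by_contra! h
    simp [Nat.le_zero.1 h] at hw
  refine ⟨fun h => ?_, key w⟩
  by_contra hw
  refine ht.isRightInversion_mul_left_iff.1 (key (w * t) ?_) h
  have h0 : ∀ a : ZMod 2, a ≠ 1 → a = 0 := by decide
  rw [inversionParity_mul, ht.inversionParity_self, mul_inv_cancel_right, h0 _ hw, add_zero]

theorem bruhatLE_of_isReflection {t u : W} (ht : cs.IsReflection t)
    (h : ¬ cs.IsRightInversion u t) : cs.bruhatLE u (u * t) :=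
  .single ⟨t, ht, rfl, (ht.length_mul_left_ne u).symm.lt_of_le (not_lt.1 fun h' => h ⟨ht, h'⟩)⟩

theorem bruhatLE_inv {u v : W} (h : cs.bruhatLE u v) : cs.bruhatLE u⁻¹ v⁻¹ := by
  induction h with
  | refl => exact .refl
  | @tail v w _ hs ih =>
    obtain ⟨t, ht, rfl, hl⟩ := hs
    refine ih.tail ⟨v * t * v⁻¹, ht.conj v, ?_, by simpa only [length_inv]⟩
    rw [mul_inv_rev, ht.inv]
    group

/-- The lifting property of the Bruhat order, in a form that does not mention descents. -/
theorem bruhatLE_mul_simple {u w : W} (h : cs.bruhatLE u w) (i : B) :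
    cs.bruhatLE (u * cs.simple i) (w * cs.simple i) ∨
      cs.bruhatLE (u * cs.simple i) w ∧ cs.bruhatLE u (w * cs.simple i) := by
  induction h with
  | refl => exact .inl .refl
  | @tail v w huv hs ih =>
    have hvw : cs.bruhatLE v w := .single hs
    obtain ⟨t, ht, rfl, hl⟩ := hs
    by_cases hti : t = cs.simple i
    · subst hti
      rw [simple_mul_simple_cancel_right]
      exact ih.elim (fun h => .inr ⟨h, huv⟩) (fun h => .inl h.1)
    · have ht' : cs.IsReflection (cs.simple i * t * cs.simple i) := by
        simpa using ht.conj (cs.simple i)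
      have hstep : cs.bruhatLE (v * cs.simple i) (v * t * cs.simple i) := by
        have h := cs.bruhatLE_of_isReflection (u := v * cs.simple i) ht' ?_
        · simpa [mul_assoc] using h
        · have hne : cs.simple i * t * cs.simple i ≠ cs.simple i := by
            rwa [Ne, mul_eq_right, mul_eq_one_iff_inv_eq, cs.inv_simple, eq_comm]
          rw [ht'.isRightInversion_iff, inversionParity_mul, inversionParity_simple,
            if_neg hne, zero_add]
          have e : cs.simple i * (cs.simple i * t * cs.simple i) * (cs.simple i)⁻¹ = t := by
            simp [mul_assoc]
          rw [e, ← ht.isRightInversion_iff]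
          exact fun h => h.2.not_gt hl
      exact ih.elim (fun h => .inl (h.trans hstep)) (fun h => .inr ⟨h.1.trans hvw, h.2.trans hstep⟩)

theorem bruhatLE_simple_mul {u w : W} (h : cs.bruhatLE u w) (i : B) :
    cs.bruhatLE (cs.simple i * u) (cs.simple i * w) ∨
      cs.bruhatLE (cs.simple i * u) w ∧ cs.bruhatLE u (cs.simple i * w) := by
  simpa using (cs.bruhatLE_mul_simple (cs.bruhatLE_inv h) i).imp cs.bruhatLE_inv
    (And.imp cs.bruhatLE_inv cs.bruhatLE_inv)

theorem bruhatLE_simple_mul_of_length_lt {w : W} {i : B}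
    (h : cs.length w < cs.length (cs.simple i * w)) : cs.bruhatLE w (cs.simple i * w) := by
  refine .single ⟨w⁻¹ * cs.simple i * w, ?_, by group, h⟩
  simpa using (cs.isReflection_simple i).conj w⁻¹

theorem induction_simple_mul {p : W → Prop} (one : p 1)
    (simple_mul : ∀ i w, cs.length w < cs.length (cs.simple i * w) → p w → p (cs.simple i * w))
    (w : W) : p w := by
  induction hn : cs.length w using Nat.strong_induction_on generalizing w with
  | _ n ih =>
    by_cases hw : w = 1
    · exact hw ▸ one
    · obtain ⟨i, hi⟩ := cs.exists_leftDescent_of_ne_one hw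
      have h := simple_mul i (cs.simple i * w) (by simpa [IsLeftDescent] using hi) (ih _ (hn ▸ hi) _ rfl)
      simpa using h

theorem bruhatLE_one_iff {w : W} : cs.bruhatLE w 1 ↔ w = 1 := by
  refine ⟨fun h => ?_, fun h => h ▸ .refl⟩
  rcases Relation.ReflTransGen.cases_tail h with h | ⟨_, _, _, _, _, hl⟩
  · exact h.symm
  · simp at hl

theorem exists_mul_bruhatLE_simple_mul {a b w : W} {i : B} (hb : cs.bruhatLE b a)
    (hw : cs.length w < cs.length (cs.simple i * w)) :
    ∃ c, cs.bruhatLE c a ∧ cs.bruhatLE (b * w) (c * (cs.simple i * w)) := by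
  by_cases hbi : cs.IsRightInversion b (cs.simple i)
  · refine ⟨b * cs.simple i, .trans ?_ hb, by simpa [mul_assoc] using .refl⟩
    have h := cs.bruhatLE_of_isReflection (cs.isReflection_simple i)
      ((cs.isReflection_simple i).not_isRightInversion_mul_left_iff.2 hbi)
    rwa [simple_mul_simple_cancel_right] at h
  · refine ⟨b, hb, ?_⟩
    have ht : cs.IsReflection (w⁻¹ * cs.simple i * w) := by
      simpa using (cs.isReflection_simple i).conj w⁻¹
    have e : w * (w⁻¹ * cs.simple i * w) * w⁻¹ = cs.simple i := by group
    have hwt : ¬ cs.IsRightInversion w (w⁻¹ * cs.simple i * w) := fun h => by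
      have := h.2
      rw [show w * (w⁻¹ * cs.simple i * w) = cs.simple i * w by group] at this
      exact this.not_gt hw
    have h := cs.bruhatLE_of_isReflection (u := b * w) ht ?_
    · rwa [show b * w * (w⁻¹ * cs.simple i * w) = b * (cs.simple i * w) by group] at h
    · have h0 : ∀ a : ZMod 2, a ≠ 1 → a = 0 := by decide
      rw [ht.isRightInversion_iff] at hwt ⊢
      rw [(cs.isReflection_simple i).isRightInversion_iff] at hbi
      rw [inversionParity_mul, e, h0 _ hwt, h0 _ hbi]
      decide

/-- Every product of elements below `a` and `w` lies below a product `c * w` with `c ≤ a`. -/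
theorem exists_mul_bruhatLE_mul {a b v w : W} (hb : cs.bruhatLE b a) (hv : cs.bruhatLE v w) :
    ∃ c, cs.bruhatLE c a ∧ cs.bruhatLE (b * v) (c * w) := by
  induction w using cs.induction_simple_mul generalizing a b v with
  | one => exact ⟨b, hb, cs.bruhatLE_one_iff.1 hv ▸ .refl⟩
  | simple_mul i w hw ih =>
    have key : ∀ {c}, cs.bruhatLE c a → cs.bruhatLE (b * v) (c * w) →
        ∃ c, cs.bruhatLE c a ∧ cs.bruhatLE (b * v) (c * (cs.simple i * w)) := fun hc h =>
      (cs.exists_mul_bruhatLE_simple_mul hc hw).imp fun _ hd => ⟨hd.1, h.trans hd.2⟩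
    have hvw : cs.bruhatLE (cs.simple i * v) w ∨ cs.bruhatLE v w := by
      simpa using (cs.bruhatLE_simple_mul hv i).imp_right And.right
    have e : b * cs.simple i * (cs.simple i * v) = b * v := by simp [mul_assoc]
    rcases hvw with hv | hv
    · rcases cs.bruhatLE_mul_simple hb i with hb | ⟨hb, -⟩
      · obtain ⟨c, hc, h⟩ := ih hb hv
        rw [e] at h
        have hca : cs.bruhatLE (c * cs.simple i) a ∨ cs.bruhatLE c a := by
          simpa using (cs.bruhatLE_mul_simple hc i).imp_right And.right
        rcases hca with hc | hc
        · exact ⟨_, hc, by simpa [mul_assoc] using h⟩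
        · exact key hc h
      · obtain ⟨c, hc, h⟩ := ih hb hv
        exact key hc (e ▸ h)
    · obtain ⟨c, hc, h⟩ := ih hb hv
      exact key hc h

theorem exists_mul_bruhatLE_mul_right {p q : W} (h : cs.bruhatLE p q) (v : W) :
    ∃ v', cs.bruhatLE v' v ∧ cs.bruhatLE (p * v') (q * v) := by
  induction v using cs.induction_simple_mul generalizing p q with
  | one => exact ⟨1, .refl, by simpa using h⟩
  | simple_mul i v hv ih =>
    have hle := cs.bruhatLE_simple_mul_of_length_lt hv
    rcases cs.bruhatLE_mul_simple h i with h | ⟨-, h⟩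
    · obtain ⟨v', hv', h'⟩ := ih h
      refine ⟨cs.simple i * v', ?_, by simpa only [mul_assoc] using h'⟩
      exact (cs.bruhatLE_simple_mul hv' i).elim id fun h => h.1.trans hle
    · obtain ⟨v', hv', h'⟩ := ih h
      exact ⟨v', hv'.trans hle, by simpa only [mul_assoc] using h'⟩

end CoxeterSystem

/-- For all `u, v, x, y ∈ W`: `u ◁ v ≤ x ∗ y` in Bruhat order iff
`u ≤ (x ∗ y) ∗ v⁻¹` in Bruhat order. -/
theorem ltr_le_star_iff {B W : Type*} [Group W] [Finite W] {M : CoxeterMatrix B}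
    (cs : CoxeterSystem M W) (star ltr : W → W → W)
    (hstar : ∀ x y : W, star x y ∈ cs.lset x y ∧
      ∀ z ∈ cs.lset x y, cs.bruhatLE z (star x y))
    (hltr : ∀ x y : W, ltr x y ∈ cs.rset x y ∧
      ∀ z ∈ cs.rset x y, cs.bruhatLE (ltr x y) z)
    (u v x y : W) :
    cs.bruhatLE (ltr u v) (star x y) ↔ cs.bruhatLE u (star (star x y) v⁻¹) := by
  constructor
  · intro h
    obtain ⟨v', hv', e⟩ := (hltr u v).1
    obtain ⟨c, hc, hu⟩ := cs.exists_mul_bruhatLE_mul (e ▸ h) (cs.bruhatLE_inv hv')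
    rw [mul_inv_cancel_right] at hu
    exact hu.trans ((hstar _ _).2 _ ⟨c, hc, rfl⟩)
  · intro h
    obtain ⟨c, hc, e⟩ := (hstar (star x y) v⁻¹).1
    obtain ⟨v', hv', hu⟩ := cs.exists_mul_bruhatLE_mul_right (e ▸ h) v
    rw [inv_mul_cancel_right] at hu
    exact (((hltr u v).2 _ ⟨v', hv', rfl⟩).trans hu).trans hc
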